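/- arXiv:1107.5608 — 5 statements merged into one kernel-verified Lean document; each statement's English description precedes it below -/
import Mathlib

section
/- For each non-zero integer x there exist integers a and b such that a·x = (2b−1)·(3b−1). -/
/-- For each non-zero integer `x` there exist integers `a`, `b` such that
`a * x = (2*b - 1) * (3*b - 1)`. -/
theorem stmt_0 : ∀ x : ℤ, x ≠ 0 → ∃ a b : ℤ, a * x = (2 * b - 1) * (3 * b - 1) := by
  intro x hx
  have hfin : FiniteMultiplicity (2 : ℤ) x := Int.finiteMultiplicity_iff.mpr ⟨by decide, hx⟩
  obtain ⟨m, hxm, hm⟩ := hfin.exists_eq_pow_mul_and_not_dvd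
  generalize multiplicity (2 : ℤ) x = k at hxm
  have hcop : IsCoprime (3 * m) ((2 : ℤ) ^ (k + 1)) := by
    obtain ⟨t, ht⟩ : ∃ t, 3 * m = 2 * t + 1 := ⟨3 * m / 2, by omega⟩
    exact IsCoprime.pow_right ⟨1, -t, by rw [ht]; ring⟩
  obtain ⟨u, v, huv⟩ := hcop
  rw [pow_succ] at huv
  refine ⟨-(u * v), v * 2 ^ k + m * u, ?_⟩
  have h₂ : 2 * (v * 2 ^ k + m * u) - 1 = -(m * u) := by linear_combination huv
  have h₃ : 3 * (v * 2 ^ k + m * u) - 1 = v * 2 ^ k := by linear_combination huv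
  rw [h₂, h₃, hxm]
  ring
end

section
/- For all integers a₁ and y₁: a₁ ≠ y₁ if and only if there exist integers a and b such that a·(a₁ − y₁) − (2b−1)·(3b−1) = 0. -/
/-- Every non-zero integer divides some number of the form `(2 * b - 1) * (3 * b - 1)`. -/
theorem exists_dvd_two_mul_sub_one_mul_three_mul_sub_one {d : ℤ} (hd : d ≠ 0) :
    ∃ b : ℤ, d ∣ (2 * b - 1) * (3 * b - 1) := by
  obtain ⟨k, m, hm, hdm⟩ := Nat.exists_eq_two_pow_mul_odd (Int.natAbs_ne_zero.mpr hd)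
  obtain ⟨c, rfl⟩ := hm
  have h3 : IsCoprime (3 : ℤ) (2 ^ k) := IsCoprime.pow_right ⟨1, -1, by norm_num⟩
  have hc : IsCoprime (2 * c + 1 : ℤ) (2 ^ k) := IsCoprime.pow_right ⟨1, -c, by ring⟩
  obtain ⟨u, v, huv⟩ := h3
  obtain ⟨x, y, hxy⟩ := hc
  refine ⟨(c + 1) * y * 2 ^ k + u * x * (2 * c + 1), ?_⟩
  rw [← Int.natAbs_dvd, hdm, mul_comm (2 * _ - 1 : ℤ)]
  push_cast
  apply mul_dvd_mul
  · exact ⟨3 * (c + 1) * y - v - y + v * y * 2 ^ k, by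
      linear_combination 3 * u * hxy + (1 - y * 2 ^ k) * huv⟩
  · exact ⟨1 - 2 * (c + 1) * x + 2 * u * x, by linear_combination 2 * (c + 1) * hxy⟩

/-- For all integers `a₁`, `y₁`: `a₁ ≠ y₁` iff there exist integers `a`, `b` with
`a * (a₁ - y₁) - (2*b - 1) * (3*b - 1) = 0`. -/
theorem stmt_2 : ∀ a₁ y₁ : ℤ,
    a₁ ≠ y₁ ↔ ∃ a b : ℤ, a * (a₁ - y₁) - (2 * b - 1) * (3 * b - 1) = 0 := by
  intro a₁ y₁
  constructor
  · intro h
    obtain ⟨b, a, hab⟩ := exists_dvd_two_mul_sub_one_mul_three_mul_sub_one (sub_ne_zero.mpr h)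
    exact ⟨a, b, by rw [hab]; ring⟩
  · rintro ⟨a, b, hab⟩ rfl
    have h : (2 * b - 1) * (3 * b - 1) = 0 := by linear_combination -hab
    rcases mul_eq_zero.mp h with h | h <;> omega
end

section
/- The 13-tuple (164, 165, 164·165, (164·165)², 132, 133, 132·133, (132·133)², 143, 144, 143·144, (143·144)², 1) belongs to B₁₃(ℕ∖{0}) if and only if the only triples (x,y,z) of positive integers satisfying x²(x+1)² + y²(y+1)² = z²(z+1)² are (132,143,164) and (143,132,164). -/
/-- `B_n(ℕ∖{0})`: the set of `n`-tuples of positive natural numbers `x` such that for every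
`n`-tuple of positive natural numbers `y`, if the three implication conditions hold then
`x₁ = y₁`. -/
def BPos (n : ℕ) [NeZero n] (x : Fin n → ℕ) : Prop :=
  (∀ i, 0 < x i) ∧
  ∀ y : Fin n → ℕ, (∀ i, 0 < y i) →
    ((∀ i, x i = 1 → y i = 1) ∧
     (∀ i j k, x i + x j = x k → y i + y j = y k) ∧
     (∀ i j k, x i * x j = x k → y i * y j = y k)) →
    x 0 = y 0

/-- The tuple `(z, z+1, z(z+1), (z(z+1))², x, …, y, …, 1)` attached to a triple `(x, y, z)`. -/
def consecutiveProductTuple (x y z : ℕ) : Fin 13 → ℕ :=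
  ![z, z + 1, z * (z + 1), (z * (z + 1)) ^ 2,
    x, x + 1, x * (x + 1), (x * (x + 1)) ^ 2,
    y, y + 1, y * (y + 1), (y * (y + 1)) ^ 2, 1]

theorem consecutiveProductTuple_pos {x y z : ℕ} (hx : 0 < x) (hy : 0 < y) (hz : 0 < z)
    (i : Fin 13) : 0 < consecutiveProductTuple x y z i := by
  fin_cases i <;> simp [consecutiveProductTuple, hx, hy, hz]

theorem eq_twelve_of_consecutiveProductTuple_eq_one :
    ∀ i, consecutiveProductTuple 132 143 164 i = 1 → i = 12 := by
  decide +kernel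

theorem add_relations_consecutiveProductTuple :
    ∀ i j k, consecutiveProductTuple 132 143 164 i + consecutiveProductTuple 132 143 164 j =
        consecutiveProductTuple 132 143 164 k →
      (j = 12 ∧ (i = 0 ∨ i = 4 ∨ i = 8) ∧ k = i + 1) ∨
      (i = 12 ∧ (j = 0 ∨ j = 4 ∨ j = 8) ∧ k = j + 1) ∨
      (i = 7 ∧ j = 11 ∧ k = 3) ∨ (i = 11 ∧ j = 7 ∧ k = 3) := by
  decide +kernel

theorem mul_relations_consecutiveProductTuple :
    ∀ i j k, consecutiveProductTuple 132 143 164 i * consecutiveProductTuple 132 143 164 j =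
        consecutiveProductTuple 132 143 164 k →
      (i = 12 ∧ k = j) ∨ (j = 12 ∧ k = i) ∨
      ((i = 0 ∨ i = 4 ∨ i = 8) ∧ j = i + 1 ∧ k = i + 2) ∨
      ((j = 0 ∨ j = 4 ∨ j = 8) ∧ i = j + 1 ∧ k = j + 2) ∨
      ((i = 2 ∨ i = 6 ∨ i = 10) ∧ j = i ∧ k = i + 1) := by
  decide +kernel

theorem le_of_sq_mul_succ_sq_add_eq {x y z : ℕ}
    (h : x ^ 2 * (x + 1) ^ 2 + y ^ 2 * (y + 1) ^ 2 = z ^ 2 * (z + 1) ^ 2) : x ≤ z := by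
  by_contra! hlt
  have : z ^ 2 * (z + 1) ^ 2 < x ^ 2 * (x + 1) ^ 2 := by gcongr
  omega

theorem eq_of_sq_mul_succ_sq_add_eq_of_le :
    ∀ x ∈ Finset.Icc 1 164, ∀ y ∈ Finset.Icc 1 164,
      x ^ 2 * (x + 1) ^ 2 + y ^ 2 * (y + 1) ^ 2 = 164 ^ 2 * (164 + 1) ^ 2 →
      (x = 132 ∧ y = 143) ∨ (x = 143 ∧ y = 132) := by
  decide +kernel

theorem stmt_3 :
    BPos 13 ![164, 165, 164 * 165, (164 * 165) ^ 2,
              132, 133, 132 * 133, (132 * 133) ^ 2,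
              143, 144, 143 * 144, (143 * 144) ^ 2, 1] ↔
    (∀ x y z : ℕ, 0 < x → 0 < y → 0 < z →
      x ^ 2 * (x + 1) ^ 2 + y ^ 2 * (y + 1) ^ 2 = z ^ 2 * (z + 1) ^ 2 →
      (x = 132 ∧ y = 143 ∧ z = 164) ∨ (x = 143 ∧ y = 132 ∧ z = 164)) := by
  change BPos 13 (consecutiveProductTuple 132 143 164) ↔ _
  constructor
  · rintro ⟨-, hB⟩ x y z hx hy hz h
    have hz164 : 164 = z := by
      refine hB (consecutiveProductTuple x y z) (consecutiveProductTuple_pos hx hy hz)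
        ⟨fun i hi => ?_, fun i j k hijk => ?_, fun i j k hijk => ?_⟩
      · rw [eq_twelve_of_consecutiveProductTuple_eq_one i hi]
        rfl
      · rcases add_relations_consecutiveProductTuple i j k hijk with
          ⟨rfl, rfl | rfl | rfl, rfl⟩ | ⟨rfl, rfl | rfl | rfl, rfl⟩ |
          ⟨rfl, rfl, rfl⟩ | ⟨rfl, rfl, rfl⟩ <;>
        simp [consecutiveProductTuple] <;> linarith
      · rcases mul_relations_consecutiveProductTuple i j k hijk with
          ⟨rfl, rfl⟩ | ⟨rfl, rfl⟩ | ⟨rfl | rfl | rfl, rfl, rfl⟩ |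
          ⟨rfl | rfl | rfl, rfl, rfl⟩ | ⟨rfl | rfl | rfl, rfl, rfl⟩ <;>
        simp [consecutiveProductTuple] <;> ring
    subst hz164
    have hxz := le_of_sq_mul_succ_sq_add_eq h
    have hyz := le_of_sq_mul_succ_sq_add_eq ((add_comm _ _).trans h)
    have := eq_of_sq_mul_succ_sq_add_eq_of_le x (Finset.mem_Icc.2 ⟨hx, hxz⟩)
      y (Finset.mem_Icc.2 ⟨hy, hyz⟩) h
    tauto
  · intro h
    refine ⟨consecutiveProductTuple_pos (by norm_num) (by norm_num) (by norm_num), ?_⟩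
    rintro w hw ⟨hone, hadd, hmul⟩
    have h12 : w 12 = 1 := hone 12 rfl
    have h1 : w 0 + w 12 = w 1 := hadd 0 12 1 rfl
    have h5 : w 4 + w 12 = w 5 := hadd 4 12 5 rfl
    have h9 : w 8 + w 12 = w 9 := hadd 8 12 9 rfl
    have hsum : w 7 + w 11 = w 3 := hadd 7 11 3 rfl
    have h2 : w 0 * w 1 = w 2 := hmul 0 1 2 rfl
    have h6 : w 4 * w 5 = w 6 := hmul 4 5 6 rfl
    have h10 : w 8 * w 9 = w 10 := hmul 8 9 10 rfl
    have h3 : w 2 * w 2 = w 3 := hmul 2 2 3 rfl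
    have h7 : w 6 * w 6 = w 7 := hmul 6 6 7 rfl
    have h11 : w 10 * w 10 = w 11 := hmul 10 10 11 rfl
    rw [← h3, ← h7, ← h11, ← h2, ← h6, ← h10, ← h1, ← h5, ← h9, h12] at hsum
    have hw0 : w 0 = 164 := by
      rcases h (w 4) (w 8) (w 0) (hw 4) (hw 8) (hw 0) (by linarith) with
        ⟨-, -, h0⟩ | ⟨-, -, h0⟩ <;> exact h0
    exact hw0.symm
end

section
/- The 15-tuple (164, 165, 164·165, (164·165)², 131, 132, 133, 132·133, (132·133)², 142, 143, 144, 143·144, (143·144)², 1) belongs to B₁₅(ℕ) if and only if the only triples (x,y,z) of positive integers satisfying x²(x+1)² + y²(y+1)² = z²(z+1)² are (132,143,164) and (143,132,164). -/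
/-- `B_n(ℕ)`: the set of `n`-tuples of natural numbers `x` such that for every
`n`-tuple of natural numbers `y`, if the three implication conditions hold then
`x₁ = y₁`. -/
def BNat (n : ℕ) [NeZero n] (x : Fin n → ℕ) : Prop :=
  ∀ y : Fin n → ℕ,
    ((∀ i, x i = 1 → y i = 1) ∧
     (∀ i j k, x i + x j = x k → y i + y j = y k) ∧
     (∀ i j k, x i * x j = x k → y i * y j = y k)) →
    x 0 = y 0

/-- The tuple with entries built from `z`, `x`, `y` in which the equation
`x²(x+1)² + y²(y+1)² = z²(z+1)²` is decomposed into elementary steps. -/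
def solutionTuple (x y z : ℕ) : Fin 15 → ℕ :=
  ![z, z + 1, z * (z + 1), (z * (z + 1)) ^ 2,
    x - 1, x, x + 1, x * (x + 1), (x * (x + 1)) ^ 2,
    y - 1, y, y + 1, y * (y + 1), (y * (y + 1)) ^ 2, 1]

theorem eq_of_solutionTuple_eq_one :
    ∀ i, solutionTuple 132 143 164 i = 1 → i = 14 := by
  decide +kernel

theorem sum_relations_solutionTuple :
    ∀ i j k, solutionTuple 132 143 164 i + solutionTuple 132 143 164 j =
      solutionTuple 132 143 164 k →
      (i, j, k) ∈ ([(0, 14, 1), (4, 14, 5), (5, 14, 6), (8, 13, 3), (9, 14, 10), (10, 14, 11)] : List (Fin 15 × Fin 15 × Fin 15)) ∨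
      (j, i, k) ∈ ([(0, 14, 1), (4, 14, 5), (5, 14, 6), (8, 13, 3), (9, 14, 10), (10, 14, 11)] : List (Fin 15 × Fin 15 × Fin 15)) := by
  decide +kernel

theorem mul_relations_solutionTuple :
    ∀ i j k, solutionTuple 132 143 164 i * solutionTuple 132 143 164 j =
      solutionTuple 132 143 164 k →
      (i = 14 ∧ j = k) ∨ (j = 14 ∧ i = k) ∨
      (i, j, k) ∈ ([(0, 1, 2), (2, 2, 3), (5, 6, 7), (7, 7, 8), (10, 11, 12), (12, 12, 13)] : List (Fin 15 × Fin 15 × Fin 15)) ∨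
      (j, i, k) ∈ ([(0, 1, 2), (2, 2, 3), (5, 6, 7), (7, 7, 8), (10, 11, 12), (12, 12, 13)] : List (Fin 15 × Fin 15 × Fin 15)) := by
  decide +kernel

theorem solutionTuple_add {x y z : ℕ} (hx : 0 < x) (hy : 0 < y)
    (h : x ^ 2 * (x + 1) ^ 2 + y ^ 2 * (y + 1) ^ 2 = z ^ 2 * (z + 1) ^ 2) (i j k : Fin 15)
    (hijk : solutionTuple 132 143 164 i + solutionTuple 132 143 164 j =
      solutionTuple 132 143 164 k) :
    solutionTuple x y z i + solutionTuple x y z j = solutionTuple x y z k := by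
  have key : ∀ i j k : Fin 15, (i, j, k) ∈ ([(0, 14, 1), (4, 14, 5), (5, 14, 6), (8, 13, 3), (9, 14, 10), (10, 14, 11)] : List (Fin 15 × Fin 15 × Fin 15)) →
      solutionTuple x y z i + solutionTuple x y z j = solutionTuple x y z k := by
    intro i j k hm
    simp only [List.mem_cons, List.not_mem_nil, or_false, Prod.mk.injEq] at hm
    rcases hm with ⟨rfl, rfl, rfl⟩ | ⟨rfl, rfl, rfl⟩ | ⟨rfl, rfl, rfl⟩ | ⟨rfl, rfl, rfl⟩ | ⟨rfl, rfl, rfl⟩ | ⟨rfl, rfl, rfl⟩ <;>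
      simp [solutionTuple, mul_pow, h] <;> omega
  rcases sum_relations_solutionTuple i j k hijk with hm | hm
  · exact key i j k hm
  · rw [add_comm]
    exact key j i k hm

theorem solutionTuple_mul (x y z : ℕ) (i j k : Fin 15)
    (hijk : solutionTuple 132 143 164 i * solutionTuple 132 143 164 j =
      solutionTuple 132 143 164 k) :
    solutionTuple x y z i * solutionTuple x y z j = solutionTuple x y z k := by
  have key : ∀ i j k : Fin 15, (i, j, k) ∈ ([(0, 1, 2), (2, 2, 3), (5, 6, 7), (7, 7, 8), (10, 11, 12), (12, 12, 13)] : List (Fin 15 × Fin 15 × Fin 15)) →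
      solutionTuple x y z i * solutionTuple x y z j = solutionTuple x y z k := by
    intro i j k hm
    simp only [List.mem_cons, List.not_mem_nil, or_false, Prod.mk.injEq] at hm
    rcases hm with ⟨rfl, rfl, rfl⟩ | ⟨rfl, rfl, rfl⟩ | ⟨rfl, rfl, rfl⟩ | ⟨rfl, rfl, rfl⟩ | ⟨rfl, rfl, rfl⟩ | ⟨rfl, rfl, rfl⟩ <;>
      simp [solutionTuple, sq]
  have hone : solutionTuple x y z 14 = 1 := rfl
  rcases mul_relations_solutionTuple i j k hijk with ⟨rfl, rfl⟩ | ⟨rfl, rfl⟩ | hm | hm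
  · rw [hone, one_mul]
  · rw [hone, mul_one]
  · exact key i j k hm
  · rw [mul_comm]
    exact key j i k hm

theorem solutions_with_largest_eq_164 :
    ∀ x y : Fin 165, 0 < x.val → 0 < y.val →
      x.val ^ 2 * (x.val + 1) ^ 2 + y.val ^ 2 * (y.val + 1) ^ 2 = 164 ^ 2 * (164 + 1) ^ 2 →
      (x.val = 132 ∧ y.val = 143) ∨ (x.val = 143 ∧ y.val = 132) := by
  decide +kernel

theorem lt_of_sq_mul_succ_sq_le {a b : ℕ}
    (h : a ^ 2 * (a + 1) ^ 2 ≤ b ^ 2 * (b + 1) ^ 2) : a < b + 1 := by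
  by_contra! hab
  have hlt : b < a := hab
  have : b ^ 2 * (b + 1) ^ 2 < a ^ 2 * (a + 1) ^ 2 := by gcongr
  omega

theorem stmt_4 :
    BNat 15 ![164, 165, 164 * 165, (164 * 165) ^ 2,
              131, 132, 133, 132 * 133, (132 * 133) ^ 2,
              142, 143, 144, 143 * 144, (143 * 144) ^ 2, 1] ↔
    (∀ x y z : ℕ, 0 < x → 0 < y → 0 < z →
      x ^ 2 * (x + 1) ^ 2 + y ^ 2 * (y + 1) ^ 2 = z ^ 2 * (z + 1) ^ 2 →
      (x = 132 ∧ y = 143 ∧ z = 164) ∨ (x = 143 ∧ y = 132 ∧ z = 164)) := by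
  constructor
  · intro hB x y z hx hy _ h
    have hz : 164 = z := hB (solutionTuple x y z)
      ⟨fun i hi => by rw [eq_of_solutionTuple_eq_one i hi]; rfl,
        solutionTuple_add hx hy h, solutionTuple_mul x y z⟩
    subst hz
    have hx' : x < 164 + 1 := lt_of_sq_mul_succ_sq_le (h ▸ Nat.le_add_right _ _)
    have hy' : y < 164 + 1 := lt_of_sq_mul_succ_sq_le (h ▸ Nat.le_add_left _ _)
    have := solutions_with_largest_eq_164 ⟨x, hx'⟩ ⟨y, hy'⟩ hx hy h
    tauto
  · rintro H w ⟨h1, hadd, hmul⟩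
    have e14 : w 14 = 1 := h1 14 rfl
    have e1 : w 0 + w 14 = w 1 := hadd 0 14 1 rfl
    have e2 : w 0 * w 1 = w 2 := hmul 0 1 2 rfl
    have e3 : w 2 * w 2 = w 3 := hmul 2 2 3 rfl
    have e5 : w 4 + w 14 = w 5 := hadd 4 14 5 rfl
    have e6 : w 5 + w 14 = w 6 := hadd 5 14 6 rfl
    have e7 : w 5 * w 6 = w 7 := hmul 5 6 7 rfl
    have e8 : w 7 * w 7 = w 8 := hmul 7 7 8 rfl
    have e10 : w 9 + w 14 = w 10 := hadd 9 14 10 rfl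
    have e11 : w 10 + w 14 = w 11 := hadd 10 14 11 rfl
    have e12 : w 10 * w 11 = w 12 := hmul 10 11 12 rfl
    have e13 : w 12 * w 12 = w 13 := hmul 12 12 13 rfl
    have e : w 8 + w 13 = w 3 := hadd 8 13 3 rfl
    rw [e14] at e1 e5 e6 e10 e11
    rw [← e3, ← e8, ← e13, ← e2, ← e7, ← e12, ← e1, ← e6, ← e11] at e
    have hx : 0 < w 5 := by omega
    have hy : 0 < w 10 := by omega
    have hz : 0 < w 0 := by
      rw [Nat.pos_iff_ne_zero]
      intro h0
      rw [h0] at e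
      have : 0 < w 5 * (w 5 + 1) * (w 5 * (w 5 + 1)) := by positivity
      omega
    have := H (w 5) (w 10) (w 0) hx hy hz (by linarith)
    change 164 = w 0
    omega
end

section
/- Fix a positive integer n. For an integer tuple (a₁,…,a_n), define the Diophantine expression D_{(a₁,…,a_n)}(a, b, y₁,…,y_n) = (a·(a₁ − y₁) − (2b−1)(3b−1))² + Σ_{i ∈ {1,…,n}, a_i = 1} (y_i − 1)² + Σ_{(i,j,k) ∈ {1,…,n}³, a_i + a_j = a_k} (y_i + y_j − y_k)² + Σ_{(i,j,k) ∈ {1,…,n}³, a_i · a_j = a_k} (y_i · y_j − y_k)². Then for every integer tuple (a₁,…,a_n): the tuple (a₁,…,a_n) does NOT belong to B_n(ℤ) if and only if there exist integers a, b, y₁,…,y_n with D_{(a₁,…,a_n)}(a, b, y₁,…,y_n) = 0. -/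
/-- `B_n(ℤ)`: the set of `n`-tuples of integers `x` such that for every
`n`-tuple of integers `y`, if the three implication conditions hold then `x₁ = y₁`. -/
def BInt (n : ℕ) [NeZero n] (x : Fin n → ℤ) : Prop :=
  ∀ y : Fin n → ℤ,
    ((∀ i, x i = 1 → y i = 1) ∧
     (∀ i j k, x i + x j = x k → y i + y j = y k) ∧
     (∀ i j k, x i * x j = x k → y i * y j = y k)) →
    x 0 = y 0

/-- The Diophantine expression `D_{(a₁,…,a_n)}(a, b, y₁,…,y_n)`. -/
def D (n : ℕ) [NeZero n] (av : Fin n → ℤ) (a b : ℤ) (y : Fin n → ℤ) : ℤ :=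
  (a * (av 0 - y 0) - (2 * b - 1) * (3 * b - 1)) ^ 2 +
  (∑ i, if av i = 1 then (y i - 1) ^ 2 else 0) +
  (∑ i, ∑ j, ∑ k, if av i + av j = av k then (y i + y j - y k) ^ 2 else 0) +
  (∑ i, ∑ j, ∑ k, if av i * av j = av k then (y i * y j - y k) ^ 2 else 0)

/-- A sum of squares over the indices satisfying `p` vanishes iff each such square does. -/
theorem sum_ite_sq_eq_zero_iff {ι : Type*} [Fintype ι] (p : ι → Prop) [DecidablePred p]
    (f : ι → ℤ) : (∑ i, if p i then f i ^ 2 else 0) = 0 ↔ ∀ i, p i → f i = 0 := by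
  rw [Finset.sum_eq_zero_iff_of_nonneg fun i _ => by split_ifs <;> positivity]
  simp

theorem sum_ite_sq_nonneg {ι : Type*} [Fintype ι] (p : ι → Prop) [DecidablePred p]
    (f : ι → ℤ) : 0 ≤ ∑ i, if p i then f i ^ 2 else 0 :=
  Finset.sum_nonneg fun i _ => by split_ifs <;> positivity

theorem D_eq_zero_iff (n : ℕ) [NeZero n] (av : Fin n → ℤ) (a b : ℤ) (y : Fin n → ℤ) :
    D n av a b y = 0 ↔
      a * (av 0 - y 0) = (2 * b - 1) * (3 * b - 1) ∧
      (∀ i, av i = 1 → y i = 1) ∧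
      (∀ i j k, av i + av j = av k → y i + y j = y k) ∧
      (∀ i j k, av i * av j = av k → y i * y j = y k) := by
  have h₀ := sq_nonneg (a * (av 0 - y 0) - (2 * b - 1) * (3 * b - 1))
  have h₁ := sum_ite_sq_nonneg (fun i => av i = 1) (fun i => y i - 1)
  have h₂ := sum_ite_sq_nonneg (fun t : Fin n × Fin n × Fin n => av t.1 + av t.2.1 = av t.2.2)
    (fun t => y t.1 + y t.2.1 - y t.2.2)
  have h₃ := sum_ite_sq_nonneg (fun t : Fin n × Fin n × Fin n => av t.1 * av t.2.1 = av t.2.2)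
    (fun t => y t.1 * y t.2.1 - y t.2.2)
  have e₁ := sum_ite_sq_eq_zero_iff (fun i => av i = 1) (fun i => y i - 1)
  have e₂ := sum_ite_sq_eq_zero_iff
    (fun t : Fin n × Fin n × Fin n => av t.1 + av t.2.1 = av t.2.2)
    (fun t => y t.1 + y t.2.1 - y t.2.2)
  have e₃ := sum_ite_sq_eq_zero_iff
    (fun t : Fin n × Fin n × Fin n => av t.1 * av t.2.1 = av t.2.2)
    (fun t => y t.1 * y t.2.1 - y t.2.2)
  simp only [Fintype.sum_prod_type, Prod.forall, sub_eq_zero] at h₂ h₃ e₁ e₂ e₃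
  rw [D, add_eq_zero_iff_of_nonneg (by positivity) h₃, add_eq_zero_iff_of_nonneg (by positivity) h₂,
    add_eq_zero_iff_of_nonneg h₀ h₁, e₁, e₂, e₃, sq_eq_zero_iff, sub_eq_zero, and_assoc, and_assoc]

theorem stmt_9 (n : ℕ) [NeZero n] :
    ∀ av : Fin n → ℤ,
      ¬ BInt n av ↔ ∃ (a b : ℤ) (y : Fin n → ℤ), D n av a b y = 0 := by
  intro av
  simp only [D_eq_zero_iff, BInt, not_forall, exists_prop]
  constructor
  · rintro ⟨y, hy, hne⟩
    obtain ⟨b, a, hab⟩ :=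
      exists_dvd_two_mul_sub_one_mul_three_mul_sub_one (sub_ne_zero.mpr hne)
    exact ⟨a, b, y, by rw [hab, mul_comm], hy⟩
  · rintro ⟨a, b, y, hab, hy⟩
    refine ⟨y, hy, fun h => ?_⟩
    rw [h, sub_self, mul_zero, eq_comm, mul_eq_zero] at hab
    omega
end
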